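/- In the group G(3,3,4) presented as <t, u, v, w | t^2=u^2=v^2=w^2=1, utu=tut, vtv=tvt, vuv=uvu, vwv=wvw, tw=wt, uw=wu, (vtu)^2=(uvt)^2>, the group is finite of order 648. -/

import Mathlib

namespace Stmt12

/-- Relations for presentation `P₁` of `G(3,3,4)`:
`⟨t,u,v,w | t² = u² = v² = w² = 1, utu = tut, vtv = tvt, vuv = uvu, vwv = wvw,
tw = wt, uw = wu, (vtu)² = (uvt)²⟩`. Here `t,u,v,w` are `of 0, of 1, of 2, of 3`. -/
def rels : Set (FreeGroup (Fin 4)) :=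
  letI t := FreeGroup.of (0 : Fin 4)
  letI u := FreeGroup.of (1 : Fin 4)
  letI v := FreeGroup.of (2 : Fin 4)
  letI w := FreeGroup.of (3 : Fin 4)
  { t ^ 2, u ^ 2, v ^ 2, w ^ 2,
    u * t * u * (t * u * t)⁻¹,
    v * t * v * (t * v * t)⁻¹,
    v * u * v * (u * v * u)⁻¹,
    v * w * v * (w * v * w)⁻¹,
    t * w * (w * t)⁻¹,
    u * w * (w * u)⁻¹,
    (v * t * u) ^ 2 * ((u * v * t) ^ 2)⁻¹ }

abbrev G334 := PresentedGroup rels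

section Upper

variable {G : Type*} [Group G]

/-- Normal form map: translations times coset representatives of `S₄`. -/
def nf (t u v w : G) (x : (Fin 3 × Fin 3 × Fin 3) × (Fin 4 × Fin 3 × Fin 2)) : G :=
  ((t * u) ^ (x.1.1 : ℕ) * (v * (t * u) * v) ^ (x.1.2.1 : ℕ) *
    (w * (v * (t * u) * v) * w) ^ (x.1.2.2 : ℕ)) *
  ((![1, w, v * w, t * v * w] x.2.1) * (![1, v, t * v] x.2.2.1) * (![1, t] x.2.2.2))

/-- The translation part. -/
def IsN (a b c x : G) : Prop := ∃ i j k : ℤ, x = a ^ i * b ^ j * c ^ k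

/-- The subset `{1, t}`. -/
def IsA (t x : G) : Prop := x = 1 ∨ x = t

/-- The `S₃` part. -/
def IsB (t v x : G) : Prop := ∃ h, IsA t h ∧ (x = h ∨ x = v * h ∨ x = t * v * h)

/-- The `S₄` part. -/
def IsC (t v w x : G) : Prop :=
  ∃ h, IsB t v h ∧ (x = h ∨ x = w * h ∨ x = v * w * h ∨ x = t * v * w * h)

theorem isA_t {t x : G} (ht : t * t = 1) (h : IsA t x) : IsA t (t * x) := by
  rcases h with rfl | rfl
  · right; simp
  · left; exact ht

theorem isB_t {t v x : G} (ht : t * t = 1) (h : IsB t v x) : IsB t v (t * x) := by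
  obtain ⟨y, hy, rfl | rfl | rfl⟩ := h
  · exact ⟨_, isA_t ht hy, Or.inl rfl⟩
  · exact ⟨y, hy, Or.inr (Or.inr (by group))⟩
  · exact ⟨y, hy, Or.inr (Or.inl (by rw [mul_assoc t, ← mul_assoc t t, ht, one_mul]))⟩

theorem isB_v {t v x : G} (ht : t * t = 1) (hv : v * v = 1) (hvt : v * t * v = t * v * t)
    (h : IsB t v x) : IsB t v (v * x) := by
  obtain ⟨y, hy, rfl | rfl | rfl⟩ := h
  · exact ⟨_, hy, Or.inr (Or.inl rfl)⟩
  · exact ⟨y, hy, Or.inl (by rw [← mul_assoc, hv, one_mul])⟩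
  · exact ⟨_, isA_t ht hy, Or.inr (Or.inr (by
      rw [← mul_assoc, ← mul_assoc, hvt, mul_assoc (t * v)]))⟩

theorem isC_t {t v w x : G} (ht : t * t = 1) (htw : t * w = w * t)
    (h : IsC t v w x) : IsC t v w (t * x) := by
  obtain ⟨y, hy, rfl | rfl | rfl | rfl⟩ := h
  · exact ⟨_, isB_t ht hy, Or.inl rfl⟩
  · exact ⟨_, isB_t ht hy, Or.inr (Or.inl (by rw [← mul_assoc, htw, mul_assoc]))⟩
  · exact ⟨y, hy, Or.inr (Or.inr (Or.inr (by group)))⟩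
  · exact ⟨y, hy, Or.inr (Or.inr (Or.inl (by simp only [← mul_assoc, ht, one_mul])))⟩

theorem isC_v {t v w x : G} (ht : t * t = 1) (hv : v * v = 1) (hvt : v * t * v = t * v * t)
    (htw : t * w = w * t) (h : IsC t v w x) : IsC t v w (v * x) := by
  obtain ⟨y, hy, rfl | rfl | rfl | rfl⟩ := h
  · exact ⟨_, isB_v ht hv hvt hy, Or.inl rfl⟩
  · exact ⟨y, hy, Or.inr (Or.inr (Or.inl (by group)))⟩
  · exact ⟨y, hy, Or.inr (Or.inl (by simp only [← mul_assoc, hv, one_mul]))⟩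
  · refine ⟨_, isB_t ht hy, Or.inr (Or.inr (Or.inr ?_))⟩
    calc v * (t * v * w * y) = (v * t * v) * (w * y) := by group
      _ = t * v * (t * w) * y := by rw [hvt]; group
      _ = _ := by rw [htw]; group

theorem isC_w {t v w x : G} (ht : t * t = 1) (hv : v * v = 1) (hw : w * w = 1)
    (hvt : v * t * v = t * v * t) (hvw : v * w * v = w * v * w)
    (htw : t * w = w * t) (h : IsC t v w x) : IsC t v w (w * x) := by
  obtain ⟨y, hy, rfl | rfl | rfl | rfl⟩ := h
  · exact ⟨_, hy, Or.inr (Or.inl rfl)⟩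
  · exact ⟨y, hy, Or.inl (by simp only [← mul_assoc, hw, one_mul])⟩
  · refine ⟨_, isB_v ht hv hvt hy, Or.inr (Or.inr (Or.inl ?_))⟩
    calc w * (v * w * y) = (w * v * w) * y := by group
      _ = _ := by rw [← hvw]; group
  · refine ⟨_, isB_v ht hv hvt hy, Or.inr (Or.inr (Or.inr ?_))⟩
    calc w * (t * v * w * y) = (w * t) * (v * w * y) := by group
      _ = t * (w * v * w) * y := by rw [← htw]; group
      _ = _ := by rw [← hvw]; group

theorem conj_form {g a b c a' b' c' : G} (ha : g * a = a' * g) (hb : g * b = b' * g)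
    (hc : g * c = c' * g) (i j k : ℤ) :
    g * (a ^ i * b ^ j * c ^ k) = (a' ^ i * b' ^ j * c' ^ k) * g := by
  have ha' : SemiconjBy g a a' := ha
  have hb' : SemiconjBy g b b' := hb
  have hc' : SemiconjBy g c c' := hc
  exact ((ha'.zpow_right i).mul_right (hb'.zpow_right j)).mul_right (hc'.zpow_right k)

theorem nf_surj (t u v w : G) (ht : t * t = 1) (hu : u * u = 1) (hv : v * v = 1)
    (hw : w * w = 1) (hut : u * t * u = t * u * t) (hvt : v * t * v = t * v * t)
    (hvu : v * u * v = u * v * u) (hvw : v * w * v = w * v * w) (htw : t * w = w * t)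
    (huw : u * w = w * u) (hr : (v * t * u) ^ 2 = (u * v * t) ^ 2)
    (hgen : Subgroup.closure {t, u, v, w} = ⊤) : Function.Surjective (nf t u v w) := by
  obtain ⟨a, hA⟩ : ∃ a, a = t * u := ⟨_, rfl⟩
  obtain ⟨b, hB⟩ : ∃ b, b = v * a * v := ⟨_, rfl⟩
  obtain ⟨c, hC⟩ : ∃ c, c = w * b * w := ⟨_, rfl⟩
  have it : t⁻¹ = t := inv_eq_of_mul_eq_one_left ht
  have iu : u⁻¹ = u := inv_eq_of_mul_eq_one_left hu
  have iv : v⁻¹ = v := inv_eq_of_mul_eq_one_left hv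
  have iw : w⁻¹ = w := inv_eq_of_mul_eq_one_left hw
  have ia : a⁻¹ = u * t := by rw [hA, mul_inv_rev, it, iu]
  have ct {x : G} : t * (t * x) = x := by rw [← mul_assoc, ht, one_mul]
  have cu {x : G} : u * (u * x) = x := by rw [← mul_assoc, hu, one_mul]
  have cv {x : G} : v * (v * x) = x := by rw [← mul_assoc, hv, one_mul]
  have cw {x : G} : w * (w * x) = x := by rw [← mul_assoc, hw, one_mul]
  have a3 : a ^ 3 = 1 := by
    calc a ^ 3 = (t * u * t) * (u * t * u) := by
          rw [hA]; simp only [pow_succ, pow_zero, one_mul, mul_assoc]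
      _ = 1 := by rw [hut]; simp only [mul_assoc, ct, cu, ht]
  have hva : v * a = b * v := by rw [hB]; simp only [mul_assoc, hv, mul_one]
  have hvb : v * b = a * v := by rw [hB]; simp only [mul_assoc, cv]
  have hwb : w * b = c * w := by rw [hC]; simp only [mul_assoc, hw, mul_one]
  have hwc : w * c = b * w := by rw [hC]; simp only [mul_assoc, cw]
  have hwa : w * a = a * w := by
    rw [hA, ← mul_assoc, ← htw, mul_assoc, ← huw, mul_assoc]
  have b3 : b ^ 3 = 1 := by
    have : b = v * a * v⁻¹ := by rw [hB, iv]
    rw [this, conj_pow, a3]; simp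
  have c3 : c ^ 3 = 1 := by
    have : c = w * b * w⁻¹ := by rw [hC, iw]
    rw [this, conj_pow, b3]; simp
  have hta : t * a = a⁻¹ * t := by rw [ia, hA]; simp only [mul_assoc, ct, ht, mul_one]
  -- both `t b t` and `u b u`
  have tbt : t * b * t = v * t * u * v * u * t := by
    calc t * b * t = (t * v * t) * u * v * t := by rw [hB, hA]; group
      _ = v * t * (v * u * v) * t := by rw [← hvt]; group
      _ = _ := by rw [hvu]; group
  have ubu : u * b * u = v * t * u * v * u * t := by
    have h1 : v * t * u * v = u * v * t * u * v * t * u * t := by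
      have : v * t * u * v * t * u = u * v * t * u * v * t := by
        simpa only [pow_two, mul_assoc] using hr
      rw [← this]; simp only [mul_assoc, cu, ht, mul_one]
    calc u * b * u = u * v * t * u * v * u := by rw [hB, hA]; group
      _ = u * v * t * u * v * ((t * u * t) * u * t) := by
        rw [← hut]; simp only [mul_assoc, ct, cu, ht, hu, mul_one]
      _ = (u * v * t * u * v * t * u * t) * u * t := by group
      _ = _ := by rw [← h1]
  have htb : t * b = (a⁻¹ * b) * t := by
    have : a⁻¹ * b = t * b * t := by
      rw [tbt, ← ubu, ia, hB, hA]
      calc u * t * (v * (t * u) * v) = u * (t * v * t) * u * v := by group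
        _ = u * v * t * (v * u * v) := by rw [← hvt]; group
        _ = _ := by rw [hvu]; group
    rw [this]; simp only [mul_assoc, ht, mul_one]
  have hab : a * b = b * a := by
    have h2 : t * b * t = u * b * u := by rw [tbt, ubu]
    calc a * b = t * (u * b * u) * u := by rw [hA]; simp only [mul_assoc, hu, mul_one]
      _ = b * a := by rw [← h2, hA]; simp only [mul_assoc, ct]
  have hac : a * c = c * a := by
    calc a * c = (a * w) * b * w := by rw [hC]; group
      _ = w * (a * b) * w := by rw [← hwa]; group
      _ = w * b * (a * w) := by rw [hab]; group
      _ = c * a := by rw [← hwa, hC]; group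
  have hvc : v * c = c * v := by
    calc v * c = (v * w * v) * a * v * w := by rw [hC, hB]; group
      _ = w * v * (w * a) * v * w := by rw [hvw]; group
      _ = w * v * a * (w * v * w) := by rw [hwa]; group
      _ = _ := by rw [← hvw, hC, hB]; group
  have hbc : b * c = c * b := by
    calc b * c = v * a * (v * c) := by rw [hB]; group
      _ = v * (a * c) * v := by rw [hvc]; group
      _ = (v * c) * a * v := by rw [hac]; group
      _ = _ := by rw [hvc, hB]; group
  have htc : t * c = (a⁻¹ * c) * t := by
    have hwa' : w * a⁻¹ = a⁻¹ * w := (show Commute w a from hwa).inv_right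
    calc t * c = (t * w) * b * w := by rw [hC]; group
      _ = w * (t * b) * w := by rw [htw]; group
      _ = (w * a⁻¹) * b * (t * w) := by rw [htb]; group
      _ = _ := by rw [hwa', htw, hC]; group
  have Cab : Commute a b := hab
  have Cac : Commute a c := hac
  have Cbc : Commute b c := hbc
  let P : G → Prop := fun x => ∃ n s, IsN a b c n ∧ IsC t v w s ∧ x = n * s
  have Pt : ∀ x, P x → P (t * x) := by
    rintro _ ⟨_, s, ⟨i, j, k, rfl⟩, hs, rfl⟩
    refine ⟨_, t * s, ⟨-i - j - k, j, k, rfl⟩, isC_t ht htw hs, ?_⟩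
    rw [← mul_assoc, conj_form hta htb htc, (Cab.inv_left).mul_zpow, (Cac.inv_left).mul_zpow,
      ← mul_assoc _ t s]
    congr 2
    rw [zpow_sub, zpow_sub, zpow_neg, inv_zpow, inv_zpow, inv_zpow]
    have h1 : b ^ j * (a ^ k)⁻¹ = (a ^ k)⁻¹ * b ^ j :=
      ((Cab.zpow_zpow k j).inv_left).symm.eq
    calc _ = (a ^ i)⁻¹ * (a ^ j)⁻¹ * (b ^ j * (a ^ k)⁻¹) * c ^ k := by
          simp only [mul_assoc]
      _ = _ := by rw [h1]; simp only [mul_assoc]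
  have Pv : ∀ x, P x → P (v * x) := by
    rintro _ ⟨_, s, ⟨i, j, k, rfl⟩, hs, rfl⟩
    refine ⟨_, v * s, ⟨j, i, k, rfl⟩, isC_v ht hv hvt htw hs, ?_⟩
    rw [← mul_assoc, conj_form hva hvb hvc, (Cab.zpow_zpow j i).eq, ← mul_assoc _ v s]
  have Pw : ∀ x, P x → P (w * x) := by
    rintro _ ⟨_, s, ⟨i, j, k, rfl⟩, hs, rfl⟩
    refine ⟨_, w * s, ⟨i, k, j, rfl⟩, isC_w ht hv hw hvt hvw htw hs, ?_⟩
    rw [← mul_assoc, conj_form hwa hwb hwc, mul_assoc (a ^ i),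
      ← (Cbc.zpow_zpow k j).eq]
    simp only [mul_assoc]
  have Pa : ∀ x, P x → P (a * x) := by
    rintro _ ⟨_, s, ⟨i, j, k, rfl⟩, hs, rfl⟩
    refine ⟨_, s, ⟨1 + i, j, k, rfl⟩, hs, ?_⟩
    rw [zpow_add, zpow_one]; simp only [mul_assoc]
  have Pu : ∀ x, P x → P (u * x) := by
    intro x hx
    have : u = t * a := by rw [hA, ct]
    rw [this, mul_assoc]
    exact Pt _ (Pa _ hx)
  have P1 : P 1 := ⟨1, 1, ⟨0, 0, 0, by simp⟩,
    ⟨1, ⟨1, Or.inl rfl, Or.inl rfl⟩, Or.inl rfl⟩, by simp⟩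
  have Pall : ∀ x, P x := by
    intro x
    have hx : x ∈ Subgroup.closure {t, u, v, w} := by rw [hgen]; trivial
    induction hx using Subgroup.closure_induction_left with
    | one => exact P1
    | mul_left g hg y _ ih =>
      rcases hg with rfl | rfl | rfl | rfl
      exacts [Pt _ ih, Pu _ ih, Pv _ ih, Pw _ ih]
    | inv_mul_cancel g hg y _ ih =>
      rcases hg with rfl | rfl | rfl | rfl
      · rw [it]; exact Pt _ ih
      · rw [iu]; exact Pu _ ih
      · rw [iv]; exact Pv _ ih
      · rw [iw]; exact Pw _ ih
  have red : ∀ g : G, g ^ 3 = 1 → ∀ i : ℤ, ∃ m : Fin 3, g ^ i = g ^ (m : ℕ) := by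
    intro g hg i
    refine ⟨⟨(i % 3).toNat, by omega⟩, ?_⟩
    have h3 : g ^ (3 : ℤ) = 1 := by exact_mod_cast hg
    have e : i = 3 * (i / 3) + ((i % 3).toNat : ℤ) := by omega
    conv_lhs => rw [e]
    rw [zpow_add, zpow_mul, h3, one_zpow, one_mul, zpow_natCast]
  intro x
  obtain ⟨_, s, ⟨i, j, k, rfl⟩, hs, rfl⟩ := Pall x
  obtain ⟨i', hi⟩ := red a a3 i
  obtain ⟨j', hj⟩ := red b b3 j
  obtain ⟨k', hk⟩ := red c c3 k
  obtain ⟨h, ⟨y, hy, hb⟩, hc⟩ := hs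
  obtain ⟨r, hr'⟩ : ∃ r : Fin 2, y = ![1, t] r := by
    rcases hy with rfl | rfl
    exacts [⟨0, rfl⟩, ⟨1, rfl⟩]
  obtain ⟨q, hq⟩ : ∃ q : Fin 3, h = ![1, v, t * v] q * y := by
    rcases hb with h | h | h
    exacts [⟨0, by simp [h]⟩, ⟨1, by simp [h]⟩, ⟨2, by simp [h]⟩]
  obtain ⟨p, hp⟩ : ∃ p : Fin 4, s = ![1, w, v * w, t * v * w] p * h := by
    rcases hc with h | h | h | h
    exacts [⟨0, by simp [h]⟩, ⟨1, by simp [h]⟩, ⟨2, by simp [h]⟩, ⟨3, by simp [h]⟩]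
  refine ⟨((i', j', k'), (p, q, r)), ?_⟩
  rw [hi, hj, hk, hp, hq, hr', hC, hB, hA]
  simp only [nf, mul_assoc]

end Upper

section Lower

open Equiv

/-- Images of the generators in `Perm (Fin 12)` (three points above each of four). -/
def gen12 : Fin 4 → Perm (Fin 12) :=
  ![swap 0 3 * swap 1 4 * swap 2 5, swap 0 4 * swap 1 5 * swap 2 3,
    swap 3 6 * swap 4 7 * swap 5 8, swap 6 9 * swap 7 10 * swap 8 11]

/-- Images of the generators in `Perm (Fin 4)`. -/
def gen4 : Fin 4 → Perm (Fin 4) := ![swap 0 1, swap 0 1, swap 1 2, swap 2 3]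

theorem rels12 : ∀ r ∈ rels, FreeGroup.lift gen12 r = 1 := by
  intro r hr
  simp only [rels, Set.mem_insert_iff, Set.mem_singleton_iff] at hr
  rcases hr with rfl | rfl | rfl | rfl | rfl | rfl | rfl | rfl | rfl | rfl | rfl <;>
    simp only [map_mul, map_pow, map_inv, FreeGroup.lift_apply_of] <;> decide +kernel

theorem rels4 : ∀ r ∈ rels, FreeGroup.lift gen4 r = 1 := by
  intro r hr
  simp only [rels, Set.mem_insert_iff, Set.mem_singleton_iff] at hr
  rcases hr with rfl | rfl | rfl | rfl | rfl | rfl | rfl | rfl | rfl | rfl | rfl <;>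
    simp only [map_mul, map_pow, map_inv, FreeGroup.lift_apply_of] <;> decide +kernel

theorem map_nf {G H : Type*} [Group G] [Group H] (f : G →* H) (t u v w : G)
    (x : (Fin 3 × Fin 3 × Fin 3) × (Fin 4 × Fin 3 × Fin 2)) :
    f (nf t u v w x) = nf (f t) (f u) (f v) (f w) x := by
  obtain ⟨⟨i, j, k⟩, p, q, r⟩ := x
  simp only [nf, map_mul, map_pow]
  congr 1
  congr 1
  · congr 1
    · fin_cases p <;> simp
    · fin_cases q <;> simp
  · fin_cases r <;> simp

theorem inj4 : ∀ x y : Fin 4 × Fin 3 × Fin 2,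
    nf (gen4 0) (gen4 1) (gen4 2) (gen4 3) ((0, 0, 0), x) =
      nf (gen4 0) (gen4 1) (gen4 2) (gen4 3) ((0, 0, 0), y) → x = y := by
  decide +kernel

theorem inj12 : ∀ x y : Fin 3 × Fin 3 × Fin 3,
    nf (gen12 0) (gen12 1) (gen12 2) (gen12 3) (x, (0, 0, 0)) =
      nf (gen12 0) (gen12 1) (gen12 2) (gen12 3) (y, (0, 0, 0)) → x = y := by
  decide +kernel

theorem nf_split {G : Type*} [Group G] (t u v w : G)
    (n : Fin 3 × Fin 3 × Fin 3) (s : Fin 4 × Fin 3 × Fin 2) :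
    nf t u v w (n, s) = nf t u v w (n, (0, 0, 0)) * nf t u v w ((0, 0, 0), s) := by
  simp [nf]

theorem nf4_triv : ∀ n : Fin 3 × Fin 3 × Fin 3,
    nf (gen4 0) (gen4 1) (gen4 2) (gen4 3) (n, (0, 0, 0)) = 1 := by
  decide +kernel

theorem nf_inj : Function.Injective
    (nf (PresentedGroup.of 0 : G334) (PresentedGroup.of 1) (PresentedGroup.of 2)
      (PresentedGroup.of 3)) := by
  rintro ⟨n, s⟩ ⟨n', s'⟩ h
  have h4 := congrArg (PresentedGroup.toGroup rels4) h
  rw [map_nf, map_nf] at h4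
  simp only [PresentedGroup.toGroup.of] at h4
  rw [nf_split, nf4_triv, nf_split _ _ _ _ n', nf4_triv, one_mul, one_mul] at h4
  have hs := inj4 _ _ h4
  subst hs
  have h12 := congrArg (PresentedGroup.toGroup rels12) h
  rw [map_nf, map_nf] at h12
  simp only [PresentedGroup.toGroup.of] at h12
  rw [nf_split, nf_split _ _ _ _ n'] at h12
  rw [inj12 _ _ (mul_right_cancel h12)]

end Lower

theorem nf_surj_G : Function.Surjective
    (nf (PresentedGroup.of 0 : G334) (PresentedGroup.of 1) (PresentedGroup.of 2)
      (PresentedGroup.of 3)) := by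
  have key : ∀ r ∈ rels, PresentedGroup.mk rels r = 1 := fun r hr =>
    PresentedGroup.one_of_mem hr
  have key2 : ∀ x y : FreeGroup (Fin 4), x * y⁻¹ ∈ rels →
      PresentedGroup.mk rels x = PresentedGroup.mk rels y := fun x y h => by
    have := key _ h
    rwa [map_mul, map_inv, mul_inv_eq_one] at this
  apply nf_surj
  · have := key (FreeGroup.of 0 ^ 2) (by simp [rels])
    rwa [map_pow, pow_two] at this
  · have := key (FreeGroup.of 1 ^ 2) (by simp [rels])
    rwa [map_pow, pow_two] at this
  · have := key (FreeGroup.of 2 ^ 2) (by simp [rels])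
    rwa [map_pow, pow_two] at this
  · have := key (FreeGroup.of 3 ^ 2) (by simp [rels])
    rwa [map_pow, pow_two] at this
  · exact key2 (.of 1 * .of 0 * .of 1) (.of 0 * .of 1 * .of 0)
      (by simp only [rels, Set.mem_insert_iff, true_or, or_true])
  · exact key2 (.of 2 * .of 0 * .of 2) (.of 0 * .of 2 * .of 0)
      (by simp only [rels, Set.mem_insert_iff, true_or, or_true])
  · exact key2 (.of 2 * .of 1 * .of 2) (.of 1 * .of 2 * .of 1)
      (by simp only [rels, Set.mem_insert_iff, true_or, or_true])
  · exact key2 (.of 2 * .of 3 * .of 2) (.of 3 * .of 2 * .of 3)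
      (by simp only [rels, Set.mem_insert_iff, true_or, or_true])
  · exact key2 (.of 0 * .of 3) (.of 3 * .of 0)
      (by simp only [rels, Set.mem_insert_iff, true_or, or_true])
  · exact key2 (.of 1 * .of 3) (.of 3 * .of 1)
      (by simp only [rels, Set.mem_insert_iff, true_or, or_true])
  · exact key2 ((.of 2 * .of 0 * .of 1) ^ 2) ((.of 1 * .of 2 * .of 0) ^ 2)
      (by simp only [rels, Set.mem_insert_iff, Set.mem_singleton_iff, or_true])
  · rw [← PresentedGroup.closure_range_of rels]
    congr 1
    ext x
    simp [Set.mem_range, Fin.exists_fin_succ, eq_comm]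

/-- The group `G(3,3,4)` presented as above is finite of order 648. -/
theorem stmt_12 : Nat.card G334 = 648 := by
  rw [← Nat.card_congr (Equiv.ofBijective _ ⟨nf_inj, nf_surj_G⟩)]
  simp

end Stmt12
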